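/- Let A ∈ M_n(ℝ₊) be such that A = αU ⊕ C (entrywise maximum), where α ∈ ℝ₊, U ∈ 𝒰_n is a max unitary matrix, and C = (c_{ij}) ∈ M_n(ℝ₊) satisfies c_{ij} ≤ α for all 1 ≤ i, j ≤ n. Then ‖A⊗B‖ = ‖B⊗A‖ for every B ∈ M_n(ℝ₊). -/

import Mathlib

open Matrix

namespace MaxAlg

variable {I J K : Type*}

/-- Entrywise nonnegative matrix (matrix over `ℝ₊`). -/
def Nonneg (A : Matrix I J ℝ) : Prop := ∀ i j, 0 ≤ A i j

/-- Max-algebra matrix product: `(A ⊗ B) i k = max_j (A i j * B j k)`. -/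
noncomputable def maxMul [Fintype J] (A : Matrix I J ℝ) (B : Matrix J K ℝ) :
    Matrix I K ℝ :=
  Matrix.of fun i k => ⨆ j, A i j * B j k

/-- Max trace: `tr_⊗(M) = max_i M i i`. -/
noncomputable def maxTrace (M : Matrix I I ℝ) : ℝ := ⨆ i, M i i

/-- Max isometry: a nonnegative matrix `X` with `Xᵗ ⊗ X = I`. -/
def IsMaxIsometry [Fintype I] [Fintype J] [DecidableEq J] (X : Matrix I J ℝ) : Prop :=
  Nonneg X ∧ maxMul Xᵀ X = 1

/-- Max numerical range `W_max(A) = {xᵗ⊗A⊗x : x ∈ ℝ₊ⁿ, xᵗ⊗x = 1}`,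
vectors being treated as `n × 1` matrices. -/
noncomputable def WMax [Fintype I] (A : Matrix I I ℝ) : Set ℝ :=
  {r | ∃ x : Matrix I (Fin 1) ℝ, Nonneg x ∧ maxMul xᵀ x = 1 ∧
    r = maxMul xᵀ (maxMul A x) 0 0}

/-- Max rank-`k` numerical range
`Λ_k^max(A) = {λ ∈ ℝ₊ : Xᵗ⊗A⊗X = λ I_k for some max isometry X}`. -/
noncomputable def LambdaMax [Fintype I] (k : ℕ) (A : Matrix I I ℝ) : Set ℝ :=
  {lam | 0 ≤ lam ∧ ∃ X : Matrix I (Fin k) ℝ, IsMaxIsometry X ∧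
    maxMul Xᵀ (maxMul A X) = lam • (1 : Matrix (Fin k) (Fin k) ℝ)}

/-- Max `k`-numerical range `W_max^k(A) = {tr_⊗(Xᵗ⊗A⊗X) : X ∈ 𝒳_{n×k}}`. -/
noncomputable def WMaxK [Fintype I] (k : ℕ) (A : Matrix I I ℝ) : Set ℝ :=
  {r | ∃ X : Matrix I (Fin k) ℝ, IsMaxIsometry X ∧
    r = maxTrace (maxMul Xᵀ (maxMul A X))}

/-- Max joint `k`-numerical range of an `m`-tuple of matrices. -/
noncomputable def WMaxKJoint [Fintype I] {m : ℕ} (k : ℕ)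
    (A : Fin m → Matrix I I ℝ) : Set (Fin m → ℝ) :=
  {v | ∃ X : Matrix I (Fin k) ℝ, IsMaxIsometry X ∧
    ∀ l, v l = maxTrace (maxMul Xᵀ (maxMul (A l) X))}

/-- Sup-norm of a real matrix: maximum absolute value of an entry. -/
noncomputable def matNorm (M : Matrix I J ℝ) : ℝ := ⨆ i, ⨆ j, |M i j|

/-- Sup-norm of a real vector: maximum absolute value of an entry. -/
noncomputable def vecNorm (v : I → ℝ) : ℝ := ⨆ i, |v i|

/-- Entrywise maximum (`max sum`) of two matrices. -/
def maxAdd (A B : Matrix I J ℝ) : Matrix I J ℝ :=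
  Matrix.of fun i j => max (A i j) (B i j)

/-- Max joint `c`-numerical range of an `m`-tuple of matrices:
`{(max_i c_i (xᵢᵗ⊗A₁⊗xᵢ), …) : X = [x₁,…,xₙ] max unitary}`; note that
`xᵢᵗ⊗A⊗xᵢ` is the `(i,i)` entry of `Xᵗ⊗A⊗X`. -/
noncomputable def WMaxCJoint {n m : ℕ} (c : Fin n → ℝ)
    (A : Fin m → Matrix (Fin n) (Fin n) ℝ) : Set (Fin m → ℝ) :=
  {v | ∃ U : Matrix (Fin n) (Fin n) ℝ, IsMaxIsometry U ∧
    ∀ l, v l = ⨆ i, c i * maxMul Uᵀ (maxMul (A l) U) i i}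

/-- Max joint `C`-numerical range of an `m`-tuple of matrices:
`{(tr_⊗(C⊗Xᵗ⊗A₁⊗X), …) : X max unitary}`. -/
noncomputable def WMaxBigCJoint {n m : ℕ} (C : Matrix (Fin n) (Fin n) ℝ)
    (A : Fin m → Matrix (Fin n) (Fin n) ℝ) : Set (Fin m → ℝ) :=
  {v | ∃ X : Matrix (Fin n) (Fin n) ℝ, IsMaxIsometry X ∧
    ∀ l, v l = maxTrace (maxMul C (maxMul Xᵀ (maxMul (A l) X)))}

lemma abs_le_matNorm [Finite I] [Finite J] (M : Matrix I J ℝ) (i : I) (j : J) :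
    |M i j| ≤ matNorm M :=
  (le_ciSup (Set.finite_range fun j => |M i j|).bddAbove j).trans
    (le_ciSup (Set.finite_range fun i => ⨆ j, |M i j|).bddAbove i)

lemma matNorm_nonneg (M : Matrix I J ℝ) : 0 ≤ matNorm M :=
  Real.iSup_nonneg fun _ => Real.iSup_nonneg fun _ => abs_nonneg _

lemma matNorm_le {M : Matrix I J ℝ} {r : ℝ} (hr : 0 ≤ r) (h : ∀ i j, |M i j| ≤ r) :
    matNorm M ≤ r :=
  Real.iSup_le (fun i => Real.iSup_le (h i) hr) hr

lemma matNorm_transpose [Finite I] [Finite J] (M : Matrix I J ℝ) :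
    matNorm Mᵀ = matNorm M :=
  le_antisymm (matNorm_le (matNorm_nonneg M) fun i j => abs_le_matNorm M j i)
    (matNorm_le (matNorm_nonneg Mᵀ) fun i j => abs_le_matNorm Mᵀ j i)

lemma transpose_maxMul [Fintype J] (A : Matrix I J ℝ) (B : Matrix J K ℝ) :
    (maxMul A B)ᵀ = maxMul Bᵀ Aᵀ := by
  ext i k
  simp [maxMul, mul_comm]

lemma mul_le_maxMul [Fintype J] (A : Matrix I J ℝ) (B : Matrix J K ℝ) (i : I) (j : J) (k : K) :
    A i j * B j k ≤ maxMul A B i k :=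
  le_ciSup (Set.finite_range fun j => A i j * B j k).bddAbove j

lemma Nonneg.maxMul [Fintype J] {A : Matrix I J ℝ} {B : Matrix J K ℝ} (hA : Nonneg A)
    (hB : Nonneg B) : Nonneg (maxMul A B) :=
  fun i k => Real.iSup_nonneg fun j => mul_nonneg (hA i j) (hB j k)

/-- If the largest entry `α` of `A` occurs in every column, then `‖A ⊗ B‖ = α ‖B‖`. -/
lemma matNorm_maxMul_of_forall_exists_eq [Finite I] [Fintype J] [Finite K] {α : ℝ} (hα : 0 ≤ α)
    {A : Matrix I J ℝ} (hA : Nonneg A) (hle : ∀ i j, A i j ≤ α) (hmax : ∀ j, ∃ i, A i j = α)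
    {B : Matrix J K ℝ} (hB : Nonneg B) : matNorm (maxMul A B) = α * matNorm B := by
  have hαB : 0 ≤ α * matNorm B := mul_nonneg hα (matNorm_nonneg B)
  apply le_antisymm
  · refine matNorm_le hαB fun i k => ?_
    rw [abs_of_nonneg (hA.maxMul hB i k)]
    refine Real.iSup_le (fun j => ?_) hαB
    exact mul_le_mul (hle i j) ((le_abs_self _).trans (abs_le_matNorm B j k)) (hB j k) hα
  · simp only [matNorm, Real.mul_iSup_of_nonneg hα]
    refine Real.iSup_le (fun j => Real.iSup_le (fun k => ?_) (matNorm_nonneg _)) (matNorm_nonneg _)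
    obtain ⟨i, rfl⟩ := hmax j
    rw [abs_of_nonneg (hB j k)]
    exact (mul_le_maxMul A B i j k).trans ((le_abs_self _).trans (abs_le_matNorm _ i k))

lemma IsMaxIsometry.le_one [Fintype I] [Fintype J] [DecidableEq J] {X : Matrix I J ℝ}
    (hX : IsMaxIsometry X) (i : I) (j : J) : X i j ≤ 1 := by
  have h := mul_le_maxMul Xᵀ X j i j
  rw [hX.2, one_apply_eq, transpose_apply] at h
  nlinarith

lemma IsMaxIsometry.exists_eq_one [Fintype I] [Fintype J] [DecidableEq J] {X : Matrix I J ℝ}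
    (hX : IsMaxIsometry X) (j : J) : ∃ i, X i j = 1 := by
  have h : ⨆ i, X i j * X i j = 1 := by
    simpa [MaxAlg.maxMul] using congr_fun (congr_fun hX.2 j) j
  cases isEmpty_or_nonempty I
  · simp at h
  · obtain ⟨i, hi⟩ := exists_eq_ciSup_of_finite (f := fun i => X i j * X i j)
    refine ⟨i, ?_⟩
    have := hX.1 i j
    nlinarith [hi.trans h]

lemma IsMaxIsometry.eq_of_eq_one [Fintype I] [Fintype J] [DecidableEq J] {X : Matrix I J ℝ}
    (hX : IsMaxIsometry X) {i : I} {j k : J} (hj : X i j = 1) (hk : X i k = 1) : j = k := by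
  by_contra hne
  have h := mul_le_maxMul Xᵀ X j i k
  rw [hX.2, one_apply_ne hne, transpose_apply, hj, hk] at h
  norm_num at h

lemma IsMaxIsometry.exists_row_eq_one [Fintype I] [DecidableEq I] {X : Matrix I I ℝ}
    (hX : IsMaxIsometry X) (i : I) : ∃ j, X i j = 1 := by
  choose f hf using hX.exists_eq_one
  have hinj : Function.Injective f := fun j k h =>
    hX.eq_of_eq_one (hf j) (h ▸ hf k)
  obtain ⟨j, rfl⟩ := Finite.surjective_of_injective hinj i
  exact ⟨j, hf j⟩

/-- if `A = αU ⊕ C` with `U` max unitary and all entries of `C`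
bounded by `α`, then `‖A⊗B‖ = ‖B⊗A‖` for every nonnegative `B`. -/
theorem matNorm_maxMul_comm {n : ℕ} (hn : 0 < n) (α : ℝ) (hα : 0 ≤ α)
    (U : Matrix (Fin n) (Fin n) ℝ) (hU : IsMaxIsometry U)
    (C : Matrix (Fin n) (Fin n) ℝ) (hC : Nonneg C) (hCα : ∀ i j, C i j ≤ α)
    (A : Matrix (Fin n) (Fin n) ℝ) (hAeq : A = maxAdd (α • U) C) :
    ∀ B : Matrix (Fin n) (Fin n) ℝ, Nonneg B →
      matNorm (maxMul A B) = matNorm (maxMul B A) := by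
  subst hAeq
  intro B hB
  have hA : Nonneg (maxAdd (α • U) C) := fun i j => (hC i j).trans (le_max_right _ _)
  have hle : ∀ i j, maxAdd (α • U) C i j ≤ α := fun i j =>
    max_le (mul_le_of_le_one_right hα (hU.le_one i j)) (hCα i j)
  have hmax : ∀ i j, U i j = 1 → maxAdd (α • U) C i j = α := fun i j h => by
    simp [maxAdd, h, hCα i j]
  rw [← matNorm_transpose (maxMul B _), transpose_maxMul,
    matNorm_maxMul_of_forall_exists_eq hα hA hle
      (fun j => (hU.exists_eq_one j).imp fun i => hmax i j) hB,
    matNorm_maxMul_of_forall_exists_eq (A := (maxAdd (α • U) C)ᵀ) (B := Bᵀ) hα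
      (fun i j => hA j i) (fun i j => hle j i)
      (fun i => (hU.exists_row_eq_one i).imp fun j => hmax i j) (fun i j => hB j i),
    matNorm_transpose]

end MaxAlg
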